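/- The much larger inclusion 𝐭 ∩ 𝐫 ⋐ 𝐛 ∩ 𝐫 holds: 𝐭 ∩ 𝐫 ⊊ 𝐛 ∩ 𝐫 and there exists a countable collection {D_j}_{j∈ℕ} ⊆ 𝐭 ∩ 𝐫 of nonempty pairwise disjoint subsets of ℕ such that for every infinite subset K ⊆ ℕ, the union ⋃_{k∈K} D_k belongs to (𝐛 ∩ 𝐫) \ (𝐭 ∩ 𝐫). -/

import Mathlib

open Filter

/-- The ideal `𝐟` of all finite subsets of `ℕ`. -/
def finIdeal : Set (Set ℕ) := {A : Set ℕ | A.Finite}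

/-- `C ⊆ D mod 𝐟`: the set `C \ D` is finite. -/
def ModF (C D : Set ℕ) : Prop := (C \ D).Finite

/-- The infinite arithmetic progression `a ℕ₀ + b = {a k + b : k ∈ ℕ₀}`. -/
def apSet (a b : ℕ) : Set ℕ := {m : ℕ | ∃ k : ℕ, m = a * k + b}

/-- `ℛ`: the set of all finite unions of infinite arithmetic progressions
`⋃_{i=1}^n (a_i ℕ₀ + b_i)` with `n ∈ ℕ` and `a_i, b_i ∈ ℕ = {1, 2, 3, …}`. -/
def calR : Set (Set ℕ) :=
  {B : Set ℕ | ∃ n : ℕ, ∃ a b : Fin (n + 1) → ℕ,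
    (∀ i, 0 < a i) ∧ (∀ i, 0 < b i) ∧ B = ⋃ i, apSet (a i) (b i)}

/-- The infinite tiling `(⋃_{j=0}^∞ (T + j r)) + b` of a tile `T` of length `r`. -/
def tiling (r b : ℕ) (T : Set ℕ) : Set ℕ :=
  {m : ℕ | ∃ t ∈ T, ∃ j : ℕ, m = t + j * r + b}

/-- `𝒯`: the set of all infinite tilings `(⋃_{j=0}^∞ (T + j r)) + b` with
`r, b ∈ ℕ = {1, 2, 3, …}` and `T ⊆ {0, 1, …, r - 1}` a tile of length `r`. -/
def calT : Set (Set ℕ) :=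
  {A : Set ℕ | ∃ r b : ℕ, 0 < r ∧ 0 < b ∧
    ∃ T : Set ℕ, T ⊆ Set.Iio r ∧ A = tiling r b T}

/-- `|X ∩ [1, n]|`. -/
noncomputable def cnt (X : Set ℕ) (n : ℕ) : ℕ := Nat.card ↥(X ∩ Set.Icc 1 n)

/-- `X` has density `δ`, i.e. `d(X) := lim_{n→∞} |X ∩ [1,n]| / n = δ`. -/
def HasDensity (X : Set ℕ) (δ : ℝ) : Prop :=
  Tendsto (fun n : ℕ => (cnt X n : ℝ) / n) atTop (nhds δ)

/-- The ideal `𝐝` of all subsets of `ℕ` with density zero. -/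
def densIdeal : Set (Set ℕ) := {X : Set ℕ | HasDensity X 0}

/-- `|X ∩ [k+1, k+n]|`. -/
noncomputable def cntI (X : Set ℕ) (k n : ℕ) : ℕ := Nat.card ↥(X ∩ Set.Icc (k + 1) (k + n))

/-- `max_{k ∈ ℕ₀} |X ∩ [k+1, k+n]|`. -/
noncomputable def maxCnt (X : Set ℕ) (n : ℕ) : ℕ := sSup {m : ℕ | ∃ k : ℕ, m = cntI X k n}

/-- The ideal `𝐛` of all subsets of `ℕ` with Banach density
`b(X) := lim_{n→∞} max_{k∈ℕ₀} |X ∩ [k+1, k+n]| / n` equal to zero. -/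
def banachIdeal : Set (Set ℕ) :=
  {X : Set ℕ | Tendsto (fun n : ℕ => (maxCnt X n : ℝ) / n) atTop (nhds 0)}

/-- The tile density `tile(X) := inf { d(A) : A ∈ 𝒯, X ⊆ A mod 𝐟 }`. -/
noncomputable def tileDens (X : Set ℕ) : ℝ :=
  sInf {δ : ℝ | ∃ A ∈ calT, ModF X A ∧ HasDensity A δ}

/-- The ideal `𝐭` of all subsets of `ℕ` with tile density zero. -/
def tileIdeal : Set (Set ℕ) := {X : Set ℕ | tileDens X = 0}

/-- The Buck density `buck(X) := inf { d(B) : B ∈ ℛ, X ⊆ B mod 𝐟 }`. -/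
noncomputable def buckDens (X : Set ℕ) : ℝ :=
  sInf {δ : ℝ | ∃ B ∈ calR, ModF X B ∧ HasDensity B δ}

/-- The ideal `𝐫` of all subsets of `ℕ` whose reciprocal series converges. -/
def recipIdeal : Set (Set ℕ) := {X : Set ℕ | Summable (X.indicator fun x : ℕ => (1 : ℝ) / x)}

/-- `𝐢 ⋐ 𝐣`: `𝐣` is much larger than `𝐢`, i.e. `𝐢 ⊊ 𝐣` and there is a countable
collection `{D_j}` of nonempty pairwise disjoint members of `𝐢` such that for every
infinite `K ⊆ ℕ` the union `⋃_{k∈K} D_k` lies in `𝐣 \ 𝐢`. -/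
def MuchLarger (i j : Set (Set ℕ)) : Prop :=
  i ⊂ j ∧ ∃ D : ℕ → Set ℕ,
    (∀ n, D n ∈ i) ∧ (∀ n, (D n).Nonempty) ∧
    (∀ m n, m ≠ n → Disjoint (D m) (D n)) ∧
    (∀ K : Set ℕ, K.Infinite → (⋃ k ∈ K, D k) ∈ j ∧ (⋃ k ∈ K, D k) ∉ i)

/-- A finite window count written as the cardinality of a filtered `Finset`. -/
theorem cntI_eq_card_filter (X : Set ℕ) [DecidablePred (· ∈ X)] (k n : ℕ) :
    cntI X k n = ((Finset.Ico (k + 1) (k + 1 + n)).filter (· ∈ X)).card := by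
  have h : X ∩ Set.Icc (k + 1) (k + n) =
      (((Finset.Ico (k + 1) (k + 1 + n)).filter (· ∈ X) : Finset ℕ) : Set ℕ) := by
    ext x
    simp only [Set.mem_inter_iff, Set.mem_Icc, Finset.coe_filter, Finset.mem_Ico,
      Set.mem_ofPred_eq]
    constructor
    · rintro ⟨h1, h2, h3⟩
      exact ⟨⟨h2, by omega⟩, h1⟩
    · rintro ⟨⟨h2, h3⟩, h1⟩
      exact ⟨h1, h2, by omega⟩
  unfold cntI
  rw [h, Nat.card_coe_set_eq, Set.ncard_coe_finset]

theorem cnt_eq_cntI_zero (X : Set ℕ) (n : ℕ) : cnt X n = cntI X 0 n := by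
  simp [cnt, cntI]

theorem cntI_mono {X Y : Set ℕ} (h : X ⊆ Y) (k n : ℕ) : cntI X k n ≤ cntI Y k n := by
  unfold cntI
  rw [Nat.card_coe_set_eq, Nat.card_coe_set_eq]
  exact Set.ncard_le_ncard (Set.inter_subset_inter_left _ h)
    ((Set.finite_Icc _ _).subset Set.inter_subset_right)

theorem cntI_mono_length (X : Set ℕ) (k : ℕ) {m n : ℕ} (h : m ≤ n) :
    cntI X k m ≤ cntI X k n := by
  unfold cntI
  rw [Nat.card_coe_set_eq, Nat.card_coe_set_eq]
  exact Set.ncard_le_ncard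
    (Set.inter_subset_inter_right _ (Set.Icc_subset_Icc_right (by omega)))
    ((Set.finite_Icc _ _).subset Set.inter_subset_right)

theorem cntI_union_le {X F : Set ℕ} (hF : F.Finite) (k n : ℕ) :
    cntI (X ∪ F) k n ≤ cntI X k n + F.ncard := by
  unfold cntI
  rw [Nat.card_coe_set_eq, Nat.card_coe_set_eq]
  calc ((X ∪ F) ∩ Set.Icc (k + 1) (k + n)).ncard
      ≤ ((X ∩ Set.Icc (k + 1) (k + n)) ∪ F).ncard := by
        refine Set.ncard_le_ncard ?_ (((Set.finite_Icc _ _).subset Set.inter_subset_right).union hF)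
        rintro x ⟨hx | hx, h⟩
        · exact Or.inl ⟨hx, h⟩
        · exact Or.inr hx
    _ ≤ _ := Set.ncard_union_le _ _

theorem maxCnt_le {X : Set ℕ} {n C : ℕ} (h : ∀ k, cntI X k n ≤ C) : maxCnt X n ≤ C := by
  refine csSup_le ⟨_, 0, rfl⟩ ?_
  rintro m ⟨k, rfl⟩
  exact h k

section Periodic

variable {p : ℕ → Prop} [DecidablePred p] {r : ℕ}

theorem cntI_mul_of_periodic (hp : Function.Periodic p r) (k q : ℕ) :
    cntI {m | p m} k (q * r) = q * Nat.count p r := by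
  classical
  induction q with
  | zero => simp [cntI_eq_card_filter]
  | succ q ih =>
    rw [cntI_eq_card_filter] at ih ⊢
    have h := Nat.filter_Ico_card_eq_of_periodic (k + 1 + q * r) r p hp
    rw [← Finset.Ico_union_Ico_eq_Ico (b := k + 1 + q * r) (by omega)
      (by nlinarith), Finset.filter_union, Finset.card_union_of_disjoint, ih,
      add_mul q 1, add_mul q 1, one_mul, one_mul, ← h, ← add_assoc (k + 1)]
    · simp
    · exact Finset.disjoint_filter_filter (Finset.Ico_disjoint_Ico_consecutive _ _ _)

theorem cntI_le_of_periodic (hr : 0 < r) (hp : Function.Periodic p r) (k n : ℕ) :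
    cntI {m | p m} k n ≤ (n / r + 1) * Nat.count p r := by
  rw [← cntI_mul_of_periodic hp k]
  refine cntI_mono_length _ _ ?_
  have := Nat.lt_div_mul_add (a := n) hr
  rw [add_mul]
  omega

theorem le_cntI_of_periodic (hp : Function.Periodic p r) (k n : ℕ) :
    n / r * Nat.count p r ≤ cntI {m | p m} k n := by
  rw [← cntI_mul_of_periodic hp k]
  exact cntI_mono_length _ _ (Nat.div_mul_le_self n r)

theorem hasDensity_of_periodic (hr : 0 < r) (hp : Function.Periodic p r) {A : Set ℕ}
    (hA : A ⊆ {m | p m}) (hfin : ({m | p m} \ A).Finite) :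
    HasDensity A (Nat.count p r / r) := by
  set τ := Nat.count p r
  set C := ({m | p m} \ A).ncard
  have hr' : (0 : ℝ) < r := by exact_mod_cast hr
  have hupper (n : ℕ) : (cnt A n : ℝ) ≤ (n / r + 1) * τ := by
    have h : cnt A n ≤ (n / r + 1) * τ := by
      rw [cnt_eq_cntI_zero]
      exact (cntI_mono hA 0 n).trans (cntI_le_of_periodic hr hp 0 n)
    calc (cnt A n : ℝ) ≤ (((n / r : ℕ) : ℝ) + 1) * τ := by exact_mod_cast h
      _ ≤ _ := by gcongr; exact Nat.cast_div_le
  have hlower (n : ℕ) : ((n : ℝ) / r - 1) * τ - C ≤ cnt A n := by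
    have h : n / r * τ ≤ cnt A n + C := by
      rw [cnt_eq_cntI_zero]
      refine (le_cntI_of_periodic hp 0 n).trans ((cntI_mono ?_ 0 n).trans
        (cntI_union_le hfin 0 n))
      rw [Set.union_sdiff_cancel hA]
    have h' : ((n / r : ℕ) : ℝ) * τ ≤ cnt A n + C := by exact_mod_cast h
    have h2 : (n : ℝ) / r - 1 ≤ ((n / r : ℕ) : ℝ) := by
      rw [sub_le_iff_le_add, div_le_iff₀ hr']
      have := Nat.lt_div_mul_add (a := n) hr
      have h3 : (n : ℝ) < (n / r : ℕ) * r + r := by exact_mod_cast this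
      linarith
    have h3 := mul_le_mul_of_nonneg_right h2 (Nat.cast_nonneg (α := ℝ) τ)
    linarith
  have hlim (c : ℝ) : Tendsto (fun n : ℕ => (τ : ℝ) / r + c / n) atTop (nhds (τ / r)) := by
    simpa using tendsto_const_nhds.add (tendsto_const_div_atTop_nhds_zero_nat c)
  refine tendsto_of_tendsto_of_tendsto_of_le_of_le' (hlim (-(τ + C))) (hlim τ) ?_ ?_
  · filter_upwards [eventually_gt_atTop 0] with n hn
    have hn' : (0 : ℝ) < n := by exact_mod_cast hn
    rw [le_div_iff₀ hn']
    have := hlower n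
    calc ((τ : ℝ) / r + -(τ + C) / n) * n = ((n : ℝ) / r - 1) * τ - C := by field_simp; ring
      _ ≤ _ := this
  · filter_upwards [eventually_gt_atTop 0] with n hn
    have hn' : (0 : ℝ) < n := by exact_mod_cast hn
    rw [div_le_iff₀ hn']
    calc (cnt A n : ℝ) ≤ (n / r + 1) * τ := hupper n
      _ = _ := by field_simp

end Periodic

/-- The periodic predicate that agrees with membership in `tiling r b T` from `b` on. -/
def TilePred (r b : ℕ) (T : Set ℕ) (m : ℕ) : Prop := (m + b * (r - 1)) % r ∈ T

theorem tilePred_periodic (r b : ℕ) (T : Set ℕ) : Function.Periodic (TilePred r b T) r := by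
  intro m
  unfold TilePred
  rw [add_right_comm, Nat.add_mod_right]

theorem tilePred_of_modEq {r b : ℕ} {T : Set ℕ} {m n : ℕ} (h : m ≡ n [MOD r])
    (hm : TilePred r b T m) : TilePred r b T n := by
  unfold TilePred at *
  rwa [← (h.add_right (b * (r - 1)) : _ % r = _ % r)]

theorem tilePred_add {r : ℕ} (hr : 0 < r) (b : ℕ) (T : Set ℕ) (m : ℕ) :
    TilePred r b T (m + b) ↔ m % r ∈ T := by
  obtain ⟨s, rfl⟩ : ∃ s, r = s + 1 := ⟨r - 1, by omega⟩
  unfold TilePred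
  rw [show m + b + b * (s + 1 - 1) = m + b * (s + 1) by rw [Nat.add_sub_cancel]; ring,
    Nat.add_mul_mod_self_right]

theorem mem_tiling_iff {r b : ℕ} (hr : 0 < r) {T : Set ℕ} (hT : T ⊆ Set.Iio r) (m : ℕ) :
    m ∈ tiling r b T ↔ b ≤ m ∧ TilePred r b T m := by
  constructor
  · rintro ⟨t, ht, j, rfl⟩
    refine ⟨by omega, ?_⟩
    rw [tilePred_add hr, Nat.add_mul_mod_self_right, Nat.mod_eq_of_lt (hT ht)]
    exact ht
  · rintro ⟨hb, hm⟩
    obtain ⟨c, rfl⟩ := Nat.exists_eq_add_of_le' hb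
    rw [tilePred_add hr] at hm
    exact ⟨_, hm, c / r, by rw [Nat.mod_add_div']⟩

open Classical in
theorem hasDensity_tiling {r b : ℕ} (hr : 0 < r) {T : Set ℕ} (hT : T ⊆ Set.Iio r) :
    HasDensity (tiling r b T) (Nat.count (TilePred r b T) r / r) := by
  refine hasDensity_of_periodic hr (tilePred_periodic r b T)
    (fun m hm => ((mem_tiling_iff hr hT m).1 hm).2) ((Set.finite_Iio b).subset ?_)
  rintro m ⟨hm, hmA⟩
  by_contra h
  exact hmA ((mem_tiling_iff hr hT m).2 ⟨not_lt.1 h, hm⟩)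

theorem HasDensity.nonneg {X : Set ℕ} {δ : ℝ} (h : HasDensity X δ) : 0 ≤ δ :=
  ge_of_tendsto' h fun n => by positivity

theorem HasDensity.unique {X : Set ℕ} {δ δ' : ℝ} (h : HasDensity X δ) (h' : HasDensity X δ') :
    δ = δ' :=
  tendsto_nhds_unique h h'

theorem bddBelow_tile_densities (X : Set ℕ) :
    BddBelow {δ : ℝ | ∃ A ∈ calT, ModF X A ∧ HasDensity A δ} :=
  ⟨0, fun _ ⟨_, _, _, h⟩ => h.nonneg⟩

theorem tile_densities_nonempty (X : Set ℕ) :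
    {δ : ℝ | ∃ A ∈ calT, ModF X A ∧ HasDensity A δ}.Nonempty := by
  refine ⟨_, tiling 1 1 (Set.Iio 1), ⟨1, 1, one_pos, one_pos, _, subset_rfl, rfl⟩, ?_,
    hasDensity_tiling one_pos subset_rfl⟩
  refine (Set.finite_Iio 1).subset ?_
  rintro m ⟨-, hm⟩
  by_contra h
  refine hm ((mem_tiling_iff one_pos subset_rfl m).2 ⟨not_lt.1 h, ?_⟩)
  simp [TilePred, Nat.mod_one]

theorem mem_tileIdeal_iff {X : Set ℕ} :
    X ∈ tileIdeal ↔ ∀ ε > 0, ∃ δ < ε, ∃ A ∈ calT, ModF X A ∧ HasDensity A δ := by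
  constructor
  · intro h ε hε
    have h' : sInf {δ : ℝ | ∃ A ∈ calT, ModF X A ∧ HasDensity A δ} < ε := by
      rw [show sInf {δ : ℝ | ∃ A ∈ calT, ModF X A ∧ HasDensity A δ} = 0 from h]
      exact hε
    obtain ⟨δ, hδ, hlt⟩ := exists_lt_of_csInf_lt (tile_densities_nonempty X) h'
    exact ⟨δ, hlt, hδ⟩
  · intro h
    refine le_antisymm (le_of_forall_pos_le_add fun ε hε => ?_)
      (le_csInf (tile_densities_nonempty X) fun _ ⟨_, _, _, h⟩ => h.nonneg)
    obtain ⟨δ, hlt, hδ⟩ := h ε hε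
    rw [zero_add]
    exact (csInf_le (bddBelow_tile_densities X) hδ).trans hlt.le

theorem tileIdeal_subset_banachIdeal : tileIdeal ⊆ banachIdeal := by
  classical
  intro X hX
  rw [mem_tileIdeal_iff] at hX
  refine tendsto_order.2 ⟨fun a ha => Eventually.of_forall fun n => ha.trans_le (by positivity),
    fun ε hε => ?_⟩
  obtain ⟨δ, hlt, A, ⟨r, b, hr, hb, T, hT, rfl⟩, hmod, hδ⟩ := hX ε hε
  rw [hδ.unique (hasDensity_tiling hr hT)] at hlt
  set τ := Nat.count (TilePred r b T) r
  set C := (X \ tiling r b T).ncard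
  have hbound (n : ℕ) : maxCnt X n ≤ (n / r + 1) * τ + C := by
    refine maxCnt_le fun k => ?_
    calc cntI X k n ≤ cntI ({m | TilePred r b T m} ∪ X \ tiling r b T) k n := by
          refine cntI_mono (fun m hm => ?_) k n
          by_cases h : m ∈ tiling r b T
          · exact Or.inl ((mem_tiling_iff hr hT m).1 h).2
          · exact Or.inr ⟨hm, h⟩
      _ ≤ cntI {m | TilePred r b T m} k n + C := cntI_union_le hmod k n
      _ ≤ _ := by
          gcongr
          exact cntI_le_of_periodic hr (tilePred_periodic r b T) k n
  have hlim : Tendsto (fun n : ℕ => (τ : ℝ) / r + (τ + C : ℝ) / n) atTop (nhds (τ / r)) := by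
    simpa using tendsto_const_nhds.add (tendsto_const_div_atTop_nhds_zero_nat (τ + C : ℝ))
  filter_upwards [hlim.eventually_lt_const hlt, eventually_gt_atTop 0] with n hn hn0
  refine lt_of_le_of_lt ?_ hn
  have hn' : (0 : ℝ) < n := by exact_mod_cast hn0
  have hr' : (0 : ℝ) < r := by exact_mod_cast hr
  rw [div_le_iff₀ hn']
  calc (maxCnt X n : ℝ) ≤ (((n / r : ℕ) : ℝ) + 1) * τ + C := by exact_mod_cast hbound n
    _ ≤ ((n : ℝ) / r + 1) * τ + C := by gcongr; exact Nat.cast_div_le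
    _ = _ := by field_simp; ring

/-- A set that meets every residue class infinitely often has positive tile density. -/
theorem notMem_tileIdeal_of_infinite_residues {X : Set ℕ}
    (h : ∀ r > 0, ∀ m, {x ∈ X | x ≡ m [MOD r]}.Infinite) : X ∉ tileIdeal := by
  classical
  rw [mem_tileIdeal_iff]
  intro hX
  obtain ⟨δ, hlt, A, ⟨r, b, hr, hb, T, hT, rfl⟩, hmod, hδ⟩ := hX 1 one_pos
  have hall : ∀ m, TilePred r b T m := by
    intro m
    obtain ⟨x, ⟨hxX, hxm⟩, hx⟩ := ((h r hr m).sdiff hmod).nonempty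
    have hxA : x ∈ tiling r b T := by
      by_contra hxA
      exact hx ⟨hxX, hxA⟩
    exact tilePred_of_modEq hxm ((mem_tiling_iff hr hT x).1 hxA).2
  rw [hδ.unique (hasDensity_tiling hr hT), (Nat.count_iff_forall).2 fun n _ => hall n,
    div_self (by positivity)] at hlt
  exact lt_irrefl _ hlt

/-- The offset of the `n`-th sparse point: it is at most `(Nat.unpair n).1`, and for fixed
`(Nat.unpair n).1 = j` it takes each value in `{0, …, j}` infinitely often. -/
def offset (n : ℕ) : ℕ := (Nat.unpair (Nat.unpair n).2).1 % ((Nat.unpair n).1 + 1)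

/-- A sparse sequence of points close to factorials. -/
def sparsePoint (n : ℕ) : ℕ := (n + 1).factorial + offset n

/-- The sparse points whose index has first unpaired component `j`. -/
def sparseSet (j : ℕ) : Set ℕ := sparsePoint '' {n | (Nat.unpair n).1 = j}

theorem offset_le (n : ℕ) : offset n ≤ (Nat.unpair n).1 :=
  Nat.lt_succ_iff.1 (Nat.mod_lt _ (Nat.succ_pos _))

theorem offset_pair (j i m : ℕ) (h : i ≤ j) : offset (Nat.pair j (Nat.pair i m)) = i := by
  simp [offset, Nat.mod_eq_of_lt (Nat.lt_succ_of_le h)]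

theorem sparsePoint_succ (n : ℕ) : sparsePoint n + (2 * n + 1) ≤ sparsePoint (n + 1) := by
  have h1 : offset n ≤ n := (offset_le n).trans (Nat.unpair_left_le n)
  have h2 : n + 1 ≤ (n + 1).factorial := Nat.self_le_factorial _
  have h3 : (n + 1 + 1).factorial = (n + 1 + 1) * (n + 1).factorial := Nat.factorial_succ _
  have h4 : n ≤ n * n := Nat.le_mul_self n
  unfold sparsePoint
  nlinarith [Nat.mul_le_mul_left n h2]

theorem sparsePoint_add (a s : ℕ) : sparsePoint a + s ^ 2 ≤ sparsePoint (a + s) := by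
  induction s with
  | zero => simp
  | succ s ih =>
    have := sparsePoint_succ (a + s)
    rw [← add_assoc]
    nlinarith

theorem sparsePoint_strictMono : StrictMono sparsePoint :=
  strictMono_nat_of_lt_succ fun n => by have := sparsePoint_succ n; omega

theorem cntI_range_sparsePoint_le (k n : ℕ) :
    cntI (Set.range sparsePoint) k n ≤ n.sqrt + 1 := by
  unfold cntI
  rw [Nat.card_coe_set_eq]
  by_cases hne : ∃ a, sparsePoint a ∈ Set.Icc (k + 1) (k + n)
  · classical
    have ha := Nat.find_spec hne
    set a := Nat.find hne
    have hsub : Set.range sparsePoint ∩ Set.Icc (k + 1) (k + n) ⊆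
        ((Finset.range (n.sqrt + 1)).image fun s => sparsePoint (a + s) : Finset ℕ) := by
      rintro _ ⟨⟨c, rfl⟩, hc⟩
      obtain ⟨s, rfl⟩ := Nat.exists_eq_add_of_le (Nat.find_min' hne hc)
      have h := sparsePoint_add a s
      have hs : s ≤ n.sqrt := by
        rw [Nat.le_sqrt']
        have h1 := ha.1
        have h2 := hc.2
        change sparsePoint (a + s) ≤ _ at h2
        omega
      simp only [Finset.coe_image, Finset.coe_range]
      exact ⟨s, Nat.lt_succ_of_le hs, rfl⟩
    calc _ ≤ _ := Set.ncard_le_ncard hsub (Finset.finite_toSet _)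
      _ ≤ _ := by
        rw [Set.ncard_coe_finset]
        exact Finset.card_image_le.trans (by simp)
  · have : Set.range sparsePoint ∩ Set.Icc (k + 1) (k + n) = ∅ := by
      rw [Set.eq_empty_iff_forall_notMem]
      rintro _ ⟨⟨c, rfl⟩, hc⟩
      exact hne ⟨c, hc⟩
    simp [this]

theorem mem_banachIdeal_of_subset_range {X : Set ℕ} (hX : X ⊆ Set.range sparsePoint) :
    X ∈ banachIdeal := by
  have hlim : Tendsto (fun n : ℕ => 1 / √(n : ℝ) + 1 / (n : ℝ)) atTop (nhds 0) := by
    have h1 : Tendsto (fun n : ℕ => 1 / √(n : ℝ)) atTop (nhds 0) := by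
      simp only [one_div]
      exact tendsto_inv_atTop_zero.comp
        (Real.tendsto_sqrt_atTop.comp tendsto_natCast_atTop_atTop)
    simpa using h1.add (tendsto_const_div_atTop_nhds_zero_nat (1 : ℝ))
  refine squeeze_zero (fun n => by positivity) (fun n => ?_) hlim
  have h : maxCnt X n ≤ n.sqrt + 1 :=
    maxCnt_le fun k => (cntI_mono hX k n).trans (cntI_range_sparsePoint_le k n)
  have h' : (maxCnt X n : ℝ) ≤ √(n : ℝ) + 1 :=
    calc (maxCnt X n : ℝ) ≤ (n.sqrt : ℝ) + 1 := by exact_mod_cast h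
      _ ≤ _ := by gcongr; exact Real.nat_sqrt_le_real_sqrt
  calc (maxCnt X n : ℝ) / n ≤ (√(n : ℝ) + 1) / n := by gcongr
    _ = _ := by rw [add_div, Real.sqrt_div_self', one_div]

theorem mem_recipIdeal_of_subset_range {X : Set ℕ} (hX : X ⊆ Set.range sparsePoint) :
    X ∈ recipIdeal := by
  have h0 : Summable fun n : ℕ => (1 : ℝ) / sparsePoint n := by
    refine Summable.of_norm_bounded_eventually_nat
      (Real.summable_one_div_nat_pow.2 one_lt_two) ?_
    filter_upwards [eventually_gt_atTop 0] with n hn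
    have h : n ^ 2 ≤ sparsePoint n := by
      have := sparsePoint_add 0 n
      rw [zero_add] at this
      omega
    rw [Real.norm_of_nonneg (by positivity)]
    have hn' : (0 : ℝ) < n := by exact_mod_cast hn
    exact one_div_le_one_div_of_le (by positivity) (by exact_mod_cast h)
  have h1 : Summable ((Set.range sparsePoint).indicator fun x : ℕ => (1 : ℝ) / x) := by
    rw [← sparsePoint_strictMono.injective.summable_iff]
    · refine h0.congr fun n => ?_
      simp
    · intro x hx
      exact Set.indicator_of_notMem hx _
  refine Summable.of_nonneg_of_le (fun x => Set.indicator_nonneg (fun _ _ => by positivity) _)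
    (fun x => Set.indicator_le_indicator_of_subset hX (fun _ => by positivity) _) h1

theorem sparseSet_subset_range (j : ℕ) : sparseSet j ⊆ Set.range sparsePoint :=
  Set.image_subset_range _ _

theorem iUnion_sparseSet_subset_range (K : Set ℕ) :
    (⋃ k ∈ K, sparseSet k) ⊆ Set.range sparsePoint :=
  Set.iUnion₂_subset fun k _ => sparseSet_subset_range k

theorem sparseSet_mem_tileIdeal (j : ℕ) : sparseSet j ∈ tileIdeal := by
  classical
  rw [mem_tileIdeal_iff]
  intro ε hε
  obtain ⟨N, hN⟩ := exists_nat_gt ((j + 1 : ℕ) / ε)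
  set r := N + j + 1
  have hr : 0 < r := by omega
  have hT : Set.Iio (j + 1) ⊆ Set.Iio r := Set.Iio_subset_Iio (by omega)
  refine ⟨_, ?_, tiling r r (Set.Iio (j + 1)), ⟨r, r, hr, hr, _, hT, rfl⟩, ?_,
    hasDensity_tiling hr hT⟩
  · have hcount : Nat.count (TilePred r r (Set.Iio (j + 1))) r = j + 1 := by
      rw [Nat.count_eq_card_filter_range]
      have : (Finset.range r).filter (TilePred r r (Set.Iio (j + 1))) = Finset.range (j + 1) := by
        ext m
        simp only [Finset.mem_filter, Finset.mem_range, TilePred, Set.mem_Iio,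
          Nat.add_mul_mod_self_left]
        constructor
        · rintro ⟨h1, h2⟩
          rwa [Nat.mod_eq_of_lt h1] at h2
        · intro h
          have h1 : m < r := by omega
          rw [Nat.mod_eq_of_lt h1]
          exact ⟨h1, h⟩
      rw [this, Finset.card_range]
    have hr' : (0 : ℝ) < r := by exact_mod_cast hr
    rw [hcount, div_lt_comm₀ hr' hε]
    exact hN.trans_le (by exact_mod_cast (by omega : N ≤ r))
  · refine ((Set.finite_Iio r).image sparsePoint).subset ?_
    rintro _ ⟨⟨n, hn, rfl⟩, hnA⟩
    refine ⟨n, ?_, rfl⟩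
    by_contra hlt
    rw [Set.mem_Iio, not_lt] at hlt
    refine hnA ⟨offset n, Nat.lt_succ_of_le ((offset_le n).trans_eq hn), ?_⟩
    obtain ⟨q, hq⟩ := Nat.dvd_factorial hr (hlt.trans (Nat.le_succ n))
    obtain ⟨c, rfl⟩ : ∃ c, q = c + 1 := by
      refine Nat.exists_eq_succ_of_ne_zero ?_
      rintro rfl
      exact Nat.factorial_ne_zero _ hq
    refine ⟨c, ?_⟩
    unfold sparsePoint
    rw [Nat.succ_eq_add_one] at hq
    rw [hq]
    ring

theorem sparseSet_infinite_residues {j r : ℕ} (hr : 0 < r) (hj : r ≤ j) (m : ℕ) :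
    {x ∈ sparseSet j | x ≡ m [MOD r]}.Infinite := by
  have hle (l : ℕ) : l ≤ Nat.pair j (Nat.pair (m % r) l) :=
    (Nat.right_le_pair _ _).trans (Nat.right_le_pair _ _)
  rw [Set.infinite_iff_exists_gt]
  intro N
  set l := N + r
  set n := Nat.pair j (Nat.pair (m % r) l) with hn
  refine ⟨sparsePoint n, ⟨⟨n, by simp [hn], rfl⟩, ?_⟩, ?_⟩
  · obtain ⟨q, hq⟩ := Nat.dvd_factorial hr
      (show r ≤ n + 1 by have := hle l; omega)
    unfold sparsePoint
    rw [hq, offset_pair _ _ _ ((Nat.mod_lt m hr).le.trans hj)]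
    simp [Nat.ModEq]
  · have h1 := hle l
    have h2 : n ≤ sparsePoint n := sparsePoint_strictMono.le_apply
    omega

theorem iUnion_sparseSet_notMem_tileIdeal {K : Set ℕ} (hK : K.Infinite) :
    (⋃ k ∈ K, sparseSet k) ∉ tileIdeal := by
  refine notMem_tileIdeal_of_infinite_residues fun r hr m => ?_
  obtain ⟨j, hjK, hj⟩ := hK.exists_gt r
  refine (sparseSet_infinite_residues hr hj.le m).mono ?_
  rintro x ⟨hx, hxm⟩
  exact ⟨Set.mem_biUnion hjK hx, hxm⟩

/-- The much larger inclusion `𝐭 ∩ 𝐫 ⋐ 𝐛 ∩ 𝐫`. -/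
theorem tile_inter_recip_muchLarger_banach_inter_recip :
    MuchLarger (tileIdeal ∩ recipIdeal) (banachIdeal ∩ recipIdeal) := by
  have hmem (K : Set ℕ) : (⋃ k ∈ K, sparseSet k) ∈ banachIdeal ∩ recipIdeal :=
    ⟨mem_banachIdeal_of_subset_range (iUnion_sparseSet_subset_range K),
      mem_recipIdeal_of_subset_range (iUnion_sparseSet_subset_range K)⟩
  refine ⟨⟨Set.inter_subset_inter_left _ tileIdeal_subset_banachIdeal, fun h =>
      iUnion_sparseSet_notMem_tileIdeal Set.infinite_univ (h (hmem Set.univ)).1⟩,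
    sparseSet, fun n => ⟨sparseSet_mem_tileIdeal n,
      mem_recipIdeal_of_subset_range (sparseSet_subset_range n)⟩, fun n => ?_, fun m n hmn => ?_,
    fun K hK => ⟨hmem K, fun h => iUnion_sparseSet_notMem_tileIdeal hK h.1⟩⟩
  · exact ⟨_, Nat.pair n 0, by simp, rfl⟩
  · rw [Set.disjoint_left]
    rintro _ ⟨a, ha, rfl⟩ ⟨b, hb, hab⟩
    rw [sparsePoint_strictMono.injective hab] at hb
    exact hmn (ha.symm.trans hb)
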